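/- Let $b \geq 0$ and $0 \leq c, d < 1$. Then for all $t > 0$, $\int_0^t \frac{e^{-b(t-s)}}{(t-s)^c (\min(s, b^{-1}))^d}\,ds \leq C(c,d)\,(\min(t, b^{-1}))^{1-c-d}$, where $C(c,d) = \max\{\mathcal{B}(1-c, 1-d), \Gamma(1-c)\}$, $\mathcal{B}$ being the Euler beta function and $\Gamma$ the gamma function. (When $b = 0$, interpret $\min(x, b^{-1})$ as $x$.) -/

import Mathlib

open MeasureTheory

lemma beta_left (c d a : ℝ) (hc1 : c < 1) (ha : 0 < a) :
    IntervalIntegrable (fun x : ℝ => x ^ (-c) * (a - x) ^ (-d)) volume 0 (a / 2) := by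
  apply IntervalIntegrable.mul_continuousOn
  · exact intervalIntegral.intervalIntegrable_rpow' (by linarith)
  · intro x hx
    rw [Set.uIcc_of_le (by positivity)] at hx
    apply ContinuousAt.continuousWithinAt
    apply ContinuousAt.rpow_const (by fun_prop)
    left
    have := hx.2
    linarith

lemma beta_int (c d a : ℝ) (hc1 : c < 1) (hd1 : d < 1) (ha : 0 < a) :
    IntegrableOn (fun x : ℝ => (a - x) ^ (-c) * x ^ (-d)) (Set.Ioo 0 a) := by
  rw [← integrableOn_Ioc_iff_integrableOn_Ioo, ← intervalIntegrable_iff_integrableOn_Ioc_of_le ha.le]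
  have h1 := beta_left d c a hd1 ha
  have h2 := (beta_left c d a hc1 ha).comp_sub_left a
  simp only [sub_sub_cancel, sub_zero, sub_half] at h2
  refine IntervalIntegrable.trans (b := a / 2) ?_ h2.symm
  simpa [mul_comm] using h1

lemma beta_scale (c d t : ℝ) (ht : 0 < t) :
    ∫ s in Set.Ioo (0:ℝ) t, (t - s) ^ (-c) * s ^ (-d) =
      (∫ x in Set.Ioo (0:ℝ) 1, x ^ (-c) * (1 - x) ^ (-d)) * t ^ (1 - c - d) := by
  have h := intervalIntegral.integral_comp_sub_div (a := 0) (b := t)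
    (fun x : ℝ => x ^ (-c) * (1 - x) ^ (-d)) ht.ne' 1
  simp only [div_self ht.ne', sub_self, zero_div, sub_zero, sub_sub_cancel, smul_eq_mul] at h
  rw [intervalIntegral.integral_of_le ht.le, intervalIntegral.integral_of_le zero_le_one,
    integral_Ioc_eq_integral_Ioo, integral_Ioc_eq_integral_Ioo] at h
  have h2 : ∫ s in Set.Ioo (0:ℝ) t, (t - s) ^ (-c) * s ^ (-d) =
      t ^ (-c - d) * ∫ s in Set.Ioo (0:ℝ) t, (1 - s / t) ^ (-c) * (s / t) ^ (-d) := by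
    rw [← integral_const_mul]
    refine setIntegral_congr_fun measurableSet_Ioo fun s hs => ?_
    have e : 1 - s / t = (t - s) / t := by field_simp
    have p1 : 0 ≤ t - s := by linarith [hs.2]
    simp only [e]
    rw [Real.div_rpow p1 ht.le, Real.div_rpow hs.1.le ht.le, sub_eq_add_neg (-c) d, Real.rpow_add ht]
    have := (Real.rpow_pos_of_pos ht (-c)).ne'
    have := (Real.rpow_pos_of_pos ht (-d)).ne'
    field_simp
  rw [h2, h, show 1 - c - d = (-c - d) + 1 by ring, Real.rpow_add_one ht.ne']
  ring

/-- the small time case -/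
lemma small_case (b c d t : ℝ) (hb : 0 ≤ b) (hc1 : c < 1) (hd1 : d < 1) (ht : 0 < t)
    (m : ℝ → ℝ) (hm : ∀ s ∈ Set.Ioo 0 t, m s = s) :
    (∫ s in Set.Ioo (0:ℝ) t, Real.exp (-b * (t - s)) / ((t - s) ^ c * (m s) ^ d))
      ≤ (∫ x in Set.Ioo (0:ℝ) 1, x ^ (-c) * (1 - x) ^ (-d)) * t ^ (1 - c - d) := by
  rw [← beta_scale c d t ht]
  apply integral_mono_of_nonneg
  · rw [Filter.EventuallyLE, ae_restrict_iff' measurableSet_Ioo]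
    refine ae_of_all _ fun s hs => ?_
    have p1 : 0 < t - s := by linarith [hs.2]
    have p2 := hs.1
    simp only [hm s hs, Pi.zero_apply]
    positivity
  · exact beta_int c d t hc1 hd1 ht
  · rw [Filter.EventuallyLE, ae_restrict_iff' measurableSet_Ioo]
    refine ae_of_all _ fun s hs => ?_
    have p1 : 0 < t - s := by linarith [hs.2]
    have p2 := hs.1
    simp only [hm s hs]
    rw [Real.rpow_neg p1.le, Real.rpow_neg p2.le, ← mul_inv, div_eq_mul_inv]
    refine mul_le_of_le_one_left (by positivity) ?_
    rw [Real.exp_le_one_iff]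
    nlinarith

/-- kernel -/
noncomputable def ker (b c : ℝ) : ℝ → ℝ :=
  (Set.Ioi (0:ℝ)).indicator fun u => u ^ (-c) * Real.exp (-(b * u))

/-- weight -/
noncomputable def wt (a d : ℝ) : ℝ → ℝ :=
  (Set.Ioi (0:ℝ)).indicator fun v => (min v a) ^ (-d)

lemma ker_int (b c : ℝ) (hb : 0 < b) (hc1 : c < 1) : Integrable (ker b c) := by
  unfold ker
  rw [integrable_indicator_iff measurableSet_Ioi]
  have := integrableOn_rpow_mul_exp_neg_mul_rpow (p := 1) (s := -c) (b := b) (by linarith) one_pos hb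
  simpa using this

lemma ker_integral (b c : ℝ) (hb : 0 < b) (hc1 : c < 1) :
    ∫ u, ker b c u = (b⁻¹) ^ (1 - c) * Real.Gamma (1 - c) := by
  unfold ker
  rw [integral_indicator measurableSet_Ioi]
  have := Real.integral_rpow_mul_exp_neg_mul_Ioi (a := 1 - c) (r := b) (by linarith) hb
  rw [one_div] at this
  rw [← this]
  congr! 3
  ring_nf

lemma ker_nonneg (b c u : ℝ) : 0 ≤ ker b c u := by
  unfold ker
  apply Set.indicator_nonneg
  intro x hx
  have : 0 < x := hx
  positivity

lemma wt_nonneg (a d v : ℝ) (ha : 0 < a) : 0 ≤ wt a d v := by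
  unfold wt
  apply Set.indicator_nonneg
  intro x hx
  have : 0 < x := hx
  positivity

lemma prod_integral (b c d t : ℝ) (hb : 0 < b) :
    (∫ s in Set.Ioo (0:ℝ) t, Real.exp (-b * (t - s)) / ((t - s) ^ c * (min s b⁻¹) ^ d))
      = ∫ v, ker b c (t - v) * wt b⁻¹ d v := by
  rw [← integral_indicator measurableSet_Ioo]
  congr 1
  ext v
  by_cases h : v ∈ Set.Ioo 0 t
  · have p1 : 0 < t - v := by linarith [h.2]
    have p2 : 0 < v := h.1
    rw [Set.indicator_of_mem h, ker, wt, Set.indicator_of_mem (show t - v ∈ Set.Ioi 0 from p1),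
      Set.indicator_of_mem (show v ∈ Set.Ioi 0 from p2)]
    have p3 : 0 < min v b⁻¹ := lt_min p2 (by positivity)
    rw [Real.rpow_neg p1.le, Real.rpow_neg p3.le, neg_mul]
    field_simp
  · rw [Set.indicator_of_notMem h]
    by_cases h1 : 0 < v
    · have : t - v ∉ Set.Ioi (0:ℝ) := fun h2 => h ⟨h1, by simpa using h2⟩
      rw [ker, Set.indicator_of_notMem this, zero_mul]
    · rw [wt, Set.indicator_of_notMem (by simpa using h1), mul_zero]

lemma prod_int (b c d t : ℝ) (hb : 0 < b) (hc : 0 ≤ c) (hc1 : c < 1) (hd1 : d < 1)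
    (ht : b⁻¹ ≤ t) :
    Integrable fun v => ker b c (t - v) * wt b⁻¹ d v := by
  have ha : 0 < b⁻¹ := by positivity
  have hB := (integrable_indicator_iff measurableSet_Ioo).2 (beta_int c d b⁻¹ hc1 hd1 ha)
  refine ((((ker_int b c hb hc1).comp_sub_left t).mul_const ((b⁻¹) ^ (-d))).add hB).mono' ?_ ?_
  · have m1 : Measurable (ker b c) := by
      unfold ker
      exact Measurable.indicator (by fun_prop) measurableSet_Ioi
    have m2 : Measurable (wt b⁻¹ d) := by
      unfold wt
      exact Measurable.indicator (by fun_prop) measurableSet_Ioi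
    exact ((m1.comp (measurable_const.sub measurable_id)).mul m2).aestronglyMeasurable
  · refine ae_of_all _ fun v => ?_
    have k0 := ker_nonneg b c (t - v)
    rw [Real.norm_of_nonneg (mul_nonneg k0 (wt_nonneg _ _ _ ha)), Pi.add_apply]
    have q0 : 0 ≤ ker b c (t - v) * (b⁻¹) ^ (-d) := mul_nonneg k0 (by positivity)
    by_cases h : v ∈ Set.Ioo 0 b⁻¹
    · have p2 : 0 < v := h.1
      have p1 : 0 < b⁻¹ - v := by linarith [h.2]
      have p3 : 0 < t - v := by linarith
      rw [Set.indicator_of_mem h]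
      refine le_trans ?_ (le_add_of_nonneg_left q0)
      rw [ker, wt, Set.indicator_of_mem (show t - v ∈ Set.Ioi 0 from p3),
        Set.indicator_of_mem (show v ∈ Set.Ioi 0 from p2), min_eq_left h.2.le]
      refine mul_le_mul_of_nonneg_right ?_ (by positivity)
      have e1 : (t - v) ^ (-c) ≤ (b⁻¹ - v) ^ (-c) :=
        Real.rpow_le_rpow_of_nonpos p1 (by linarith) (by linarith)
      have e2 : Real.exp (-(b * (t - v))) ≤ 1 := by
        rw [Real.exp_le_one_iff]
        nlinarith
      exact (mul_le_of_le_one_right (by positivity) e2).trans e1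
    · rw [Set.indicator_of_notMem h, add_zero]
      refine mul_le_mul_of_nonneg_left ?_ k0
      by_cases h1 : 0 < v
      · have : b⁻¹ ≤ v := not_lt.1 fun h2 => h ⟨h1, h2⟩
        rw [wt, Set.indicator_of_mem (show v ∈ Set.Ioi 0 from h1), min_eq_right this]
      · rw [wt, Set.indicator_of_notMem (by simpa using h1)]
        positivity

lemma ker_pos (b c u : ℝ) (hu : 0 < u) : 0 < ker b c u := by
  rw [ker, Set.indicator_of_mem (show u ∈ Set.Ioi 0 from hu)]
  positivity

lemma ker_mul (b c x y x₁ y₁ : ℝ) (hc : 0 ≤ c) (hx : 0 < x) (hy : 0 < y) (hx₁ : 0 < x₁)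
    (hy₁ : 0 < y₁) (h : x * y ≤ x₁ * y₁) (hs : x + y = x₁ + y₁) :
    ker b c x₁ * ker b c y₁ ≤ ker b c x * ker b c y := by
  have e : ∀ p q : ℝ, 0 < p → 0 < q →
      ker b c p * ker b c q = (p * q) ^ (-c) * Real.exp (-(b * (p + q))) := by
    intro p q hp hq
    rw [ker, Set.indicator_of_mem (show p ∈ Set.Ioi 0 from hp),
      Set.indicator_of_mem (show q ∈ Set.Ioi 0 from hq), Real.mul_rpow hp.le hq.le,
      mul_add, neg_add, Real.exp_add]
    ring
  rw [e _ _ hx hy, e _ _ hx₁ hy₁, hs]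
  refine mul_le_mul_of_nonneg_right ?_ (by positivity)
  exact Real.rpow_le_rpow_of_nonpos (by positivity) h (by linarith)

lemma pointwise (b c d t v : ℝ) (hb : 0 < b) (hc : 0 ≤ c) (hd : 0 ≤ d)
    (ht : b⁻¹ ≤ t) :
    (ker b c t / ker b c b⁻¹) * (ker b c (b⁻¹ - v) * ((b⁻¹) ^ (-d) - wt b⁻¹ d v)) ≤
      ker b c (t - v) * ((b⁻¹) ^ (-d) - wt b⁻¹ d v) := by
  have ha : 0 < b⁻¹ := by positivity
  have ht0 : 0 < t := by linarith
  have hka := ker_pos b c _ ha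
  rw [← mul_assoc]
  rcases le_or_gt v 0 with h | h
  · rw [wt, Set.indicator_of_notMem (by simpa using h), sub_zero]
    refine mul_le_mul_of_nonneg_right ?_ (by positivity)
    rw [div_mul_eq_mul_div, div_le_iff₀ hka]
    exact ker_mul b c _ _ _ _ hc (by linarith) ha ht0 (by linarith) (by nlinarith) (by ring)
  · rcases lt_or_ge v b⁻¹ with h1 | h1
    · rw [wt, Set.indicator_of_mem (show v ∈ Set.Ioi 0 from h), min_eq_left h1.le]
      refine mul_le_mul_of_nonpos_right ?_ ?_
      · rw [div_mul_eq_mul_div, le_div_iff₀ hka]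
        exact ker_mul b c _ _ _ _ hc ht0 (by linarith) (by linarith) ha (by nlinarith) (by ring)
      · exact sub_nonpos.2 (Real.rpow_le_rpow_of_nonpos h h1.le (by linarith))
    · rw [wt, Set.indicator_of_mem (show v ∈ Set.Ioi 0 from h), min_eq_right h1]
      simp

lemma lam_le (b c t : ℝ) (hb : 0 < b) (hc : 0 ≤ c) (ht : b⁻¹ ≤ t) :
    ker b c t / ker b c b⁻¹ ≤ 1 := by
  have ha : 0 < b⁻¹ := by positivity
  have ht0 : 0 < t := by linarith
  rw [ker, Set.indicator_of_mem (show t ∈ Set.Ioi 0 from ht0),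
    Set.indicator_of_mem (show b⁻¹ ∈ Set.Ioi 0 from ha)]
  apply div_le_one_of_le₀ _ (by positivity)
  apply mul_le_mul _ _ (by positivity) (by positivity)
  · exact Real.rpow_le_rpow_of_nonpos ha ht (by linarith)
  · rw [Real.exp_le_exp]
    nlinarith

lemma diff_integral (b c d t : ℝ) (hb : 0 < b) (hc : 0 ≤ c) (hc1 : c < 1) (hd1 : d < 1)
    (ht : b⁻¹ ≤ t) :
    ∫ v, ker b c (t - v) * ((b⁻¹) ^ (-d) - wt b⁻¹ d v) =
      Real.Gamma (1 - c) * (b⁻¹) ^ (1 - c - d) - ∫ v, ker b c (t - v) * wt b⁻¹ d v := by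
  simp only [mul_sub]
  rw [integral_sub (((ker_int b c hb hc1).comp_sub_left t).mul_const _) (prod_int b c d t hb hc hc1 hd1 ht),
    integral_mul_const, integral_sub_left_eq_self (ker b c) volume t, ker_integral b c hb hc1,
    sub_eq_add_neg (1 - c) d, Real.rpow_add (by positivity)]
  ring

lemma large_case (b c d t : ℝ) (hb : 0 < b) (hc : 0 ≤ c) (hc1 : c < 1) (hd : 0 ≤ d) (hd1 : d < 1)
    (ht : b⁻¹ ≤ t) :
    (∫ s in Set.Ioo (0:ℝ) t, Real.exp (-b * (t - s)) / ((t - s) ^ c * (min s b⁻¹) ^ d))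
      ≤ max (∫ x in Set.Ioo (0:ℝ) 1, x ^ (-c) * (1 - x) ^ (-d)) (Real.Gamma (1 - c)) *
          (b⁻¹) ^ (1 - c - d) := by
  have ha : 0 < b⁻¹ := by positivity
  have hs := small_case b c d b⁻¹ hb.le hc1 hd1 ha (fun s => min s b⁻¹)
    (fun s hs => min_eq_left hs.2.le)
  simp only [prod_integral _ _ _ _ hb] at hs ⊢
  have i1 : ∀ T, b⁻¹ ≤ T → Integrable fun v => ker b c (T - v) * ((b⁻¹) ^ (-d) - wt b⁻¹ d v) := by
    intro T hT
    simp only [mul_sub]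
    exact (((ker_int b c hb hc1).comp_sub_left T).mul_const _).sub (prod_int b c d T hb hc hc1 hd1 hT)
  have key := integral_mono ((i1 b⁻¹ le_rfl).const_mul (ker b c t / ker b c b⁻¹)) (i1 t ht)
    (fun v => pointwise b c d t v hb hc hd ht)
  rw [integral_const_mul, diff_integral b c d t hb hc hc1 hd1 ht,
    diff_integral b c d b⁻¹ hb hc hc1 hd1 le_rfl] at key
  have l1 := lam_le b c t hb hc ht
  have l0 : 0 ≤ ker b c t / ker b c b⁻¹ := div_nonneg (ker_nonneg _ _ _) (ker_nonneg _ _ _)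
  set l := ker b c t / ker b c b⁻¹
  have hp : 0 ≤ (b⁻¹) ^ (1 - c - d) := by positivity
  have m1 := mul_le_mul_of_nonneg_right (le_max_left (∫ x in Set.Ioo (0:ℝ) 1, x ^ (-c) * (1 - x) ^ (-d)) (Real.Gamma (1 - c))) hp
  have m2 := mul_le_mul_of_nonneg_right (le_max_right (∫ x in Set.Ioo (0:ℝ) 1, x ^ (-c) * (1 - x) ^ (-d)) (Real.Gamma (1 - c))) hp
  have := mul_le_mul_of_nonneg_left (hs.trans m1) l0
  have := mul_le_mul_of_nonneg_left m2 (sub_nonneg.2 l1)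
  nlinarith

/-- Proposition (beta/gamma integral bound): for `b ≥ 0`, `0 ≤ c,d < 1` and `t > 0`,
`∫₀ᵗ e^{-b(t-s)} / ((t-s)^c (min(s,b⁻¹))^d) ds ≤ max{B(1-c,1-d), Γ(1-c)} (min(t,b⁻¹))^{1-c-d}`,
where for `b = 0` one interprets `min(x, b⁻¹)` as `x`. -/
theorem stmt0 (b c d t : ℝ) (hb : 0 ≤ b) (hc : 0 ≤ c) (hc1 : c < 1)
    (hd : 0 ≤ d) (hd1 : d < 1) (ht : 0 < t) :
    (∫ s in Set.Ioo (0:ℝ) t,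
        Real.exp (-b * (t - s)) / ((t - s) ^ c * (if b = 0 then s else min s b⁻¹) ^ d))
      ≤ max (∫ x in Set.Ioo (0:ℝ) 1, x ^ (-c) * (1 - x) ^ (-d)) (Real.Gamma (1 - c)) *
          (if b = 0 then t else min t b⁻¹) ^ (1 - c - d) := by
  by_cases h : b = 0
  · simp only [if_pos h]
    refine (small_case b c d t hb hc1 hd1 ht (fun s => s) (fun s _ => rfl)).trans ?_
    exact mul_le_mul_of_nonneg_right (le_max_left _ _) (by positivity)
  · simp only [if_neg h]
    rcases le_total t b⁻¹ with h1 | h1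
    · rw [min_eq_left h1]
      refine (small_case b c d t hb hc1 hd1 ht (fun s => min s b⁻¹)
        (fun s hs => min_eq_left (hs.2.le.trans h1))).trans ?_
      exact mul_le_mul_of_nonneg_right (le_max_left _ _) (by positivity)
    · rw [min_eq_right h1]
      exact large_case b c d t (lt_of_le_of_ne hb (Ne.symm h)) hc hc1 hd hd1 h1
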